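/- Let f : ℝ^n → ℝ be p times continuously differentiable (p ≥ 1) with x ↦ D^p f(x) Lipschitz continuous. Let (x_k) be a sequence in ℝ^n converging to x_* ∈ ℝ^n with nonzero steps s_k = x_{k+1} − x_k, and let (W_k) be nonsingular matrices converging to a nonsingular matrix W_* ∈ ℝ^{n×n}, with the summability conditions Σ_{k≥0} ‖x_k − x_*‖_2 < ∞ and Σ_{k≥0} ‖W_k − W_*‖_2 < ∞. Let C_0 be any symmetric p-tensor and for each k let C_{k+1} be the unique symmetric p-tensor minimizing ‖(C − C_k)[W_k]^p‖_F over all symmetric p-tensors C satisfying C[s_k] = D^{p−1} f(x_{k+1}) − D^{p−1} f(x_k). Then the generalized Dennis–Moré condition holds: ‖(C_k − D^p f(x_*))[s_k]‖_F / ‖s_k‖_2 → 0 as k → ∞. -/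

import Mathlib

open scoped BigOperators
open Matrix Filter

noncomputable section

/-- A `q`-tensor on `ℝ^n` (a multilinear map `(ℝ^n)^q → ℝ`), represented by its
coefficient array on the standard basis. -/
abbrev Tensor (n q : ℕ) := (Fin q → Fin n) → ℝ

namespace Tensor

/-- Evaluation of a tensor (as a multilinear map) on the vectors `u 0, …, u (q-1)`. -/
def eval {n q : ℕ} (T : Tensor n q) (u : Fin q → (Fin n → ℝ)) : ℝ :=
  ∑ i : Fin q → Fin n, T i * ∏ k, u k (i k)

/-- A tensor is symmetric if it is invariant under all permutations of its arguments. -/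
def Symm {n q : ℕ} (T : Tensor n q) : Prop :=
  ∀ σ : Equiv.Perm (Fin q), ∀ i : Fin q → Fin n, T (i ∘ σ) = T i

/-- The Frobenius norm of a tensor: the Euclidean norm of its coefficient array. -/
def frobNorm {n q : ℕ} (T : Tensor n q) : ℝ :=
  Real.sqrt (∑ i : Fin q → Fin n, (T i) ^ 2)

/-- The Frobenius inner product of two tensors. -/
def finner {n q : ℕ} (T S : Tensor n q) : ℝ := ∑ i : Fin q → Fin n, T i * S i

/-- The symmetric projection `P_sym(T) = (1/q!) ∑_σ σ(T)`. -/
def psym {n q : ℕ} (T : Tensor n q) : Tensor n q :=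
  fun i => ((Nat.factorial q : ℝ))⁻¹ * ∑ σ : Equiv.Perm (Fin q), T (i ∘ σ)

/-- `T[W]^q`: apply the matrix `W` to every argument of `T`. -/
def applyMat {n q : ℕ} (T : Tensor n q) (W : Matrix (Fin n) (Fin n) ℝ) : Tensor n q :=
  fun j => ∑ i : Fin q → Fin n, T i * ∏ k, W (i k) (j k)

/-- `T[v]^j`: fix the first `j` arguments of `T` to the vector `v`,
yielding a `(q-j)`-tensor. -/
def fixMany {n q : ℕ} (T : Tensor n q) (v : Fin n → ℝ) (j : ℕ) : Tensor n (q - j) :=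
  fun idx => ∑ i : Fin j → Fin n, (∏ k, v (i k)) *
    T (fun k => if h : (k : ℕ) < j then i ⟨k, h⟩
        else idx ⟨(k : ℕ) - j, by have hk := k.isLt; omega⟩)

/-- The outer product of two tensors. -/
def outer {n a b : ℕ} (T : Tensor n a) (S : Tensor n b) : Tensor n (a + b) :=
  fun idx => T (fun k => idx (Fin.castAdd b k)) * S (fun k => idx (Fin.natAdd a k))

/-- Reindexing a tensor along an equality of orders. -/
def castOrder {n a b : ℕ} (h : a = b) (T : Tensor n a) : Tensor n b :=
  fun idx => T (fun k => idx (Fin.cast h k))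

/-- Apply a matrix to the first argument of a tensor only. -/
def applyFirst {n q : ℕ} (hq : 0 < q) (T : Tensor n q) (M : Matrix (Fin n) (Fin n) ℝ) :
    Tensor n q :=
  fun idx => ∑ i : Fin n, M i (idx ⟨0, hq⟩) * T (Function.update idx ⟨0, hq⟩ i)

end Tensor

/-- `⊗^j v`, the `j`-fold outer product of a vector `v` with itself. -/
def vpow {n : ℕ} (j : ℕ) (v : Fin n → ℝ) : Tensor n j := fun idx => ∏ k, v (idx k)

/-- The Euclidean (2-) norm of a vector in `ℝ^n`. -/
def vnorm {n : ℕ} (v : Fin n → ℝ) : ℝ := Real.sqrt (∑ i, v i ^ 2)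

/-- The injective (2-) norm of a tensor:
the supremum of `|T[u_1,…,u_q]|` over unit vectors. -/
def Tensor.inj2Norm {n q : ℕ} (T : Tensor n q) : ℝ :=
  sSup ((fun u => |T.eval u|) '' {u : Fin q → Fin n → ℝ | ∀ k, vnorm (u k) = 1})

/-- The spectral (operator 2-) norm of a matrix. -/
def specNorm {n : ℕ} (M : Matrix (Fin n) (Fin n) ℝ) : ℝ :=
  ‖Matrix.toEuclideanCLM (𝕜 := ℝ) M‖

/-- The orthogonal projection `I - w wᵀ / (wᵀ w)` onto the orthogonal complement of `w`. -/
def projPerp {n : ℕ} (w : Fin n → ℝ) : Matrix (Fin n) (Fin n) ℝ :=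
  1 - (w ⬝ᵥ w)⁻¹ • Matrix.vecMulVec w w

/-- `Cp` is a least-change symmetric update of `Cb` in the `W`-weighted Frobenius norm,
subject to the secant equation `Cp[s] = R`. -/
def IsSecantUpdate {n p : ℕ} (Cb : Tensor n p) (R : Tensor n (p - 1))
    (W : Matrix (Fin n) (Fin n) ℝ) (s : Fin n → ℝ) (Cp : Tensor n p) : Prop :=
  Cp.Symm ∧ Cp.fixMany s 1 = R ∧
    ∀ C : Tensor n p, C.Symm → C.fixMany s 1 = R →
      ((Cp - Cb).applyMat W).frobNorm ≤ ((C - Cb).applyMat W).frobNorm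

/-- The explicit higher-order secant update formula of Theorem 1 (b):
`C• + ∑_{j=1}^p (-1)^{j+1} C(p,j) (vᵀs)^{-j} P_sym((⊗^j v) ⊗ (C̃ - C•)[s]^j)`. -/
def hosuFormula {n p : ℕ} (Cb Ct : Tensor n p) (v s : Fin n → ℝ) : Tensor n p :=
  Cb + ∑ j ∈ (Finset.Icc 1 p).attach,
    ((-1 : ℝ) ^ ((j : ℕ) + 1) * (p.choose (j : ℕ) : ℝ) * ((v ⬝ᵥ s) ^ (j : ℕ))⁻¹) •
      Tensor.castOrder (Nat.add_sub_cancel' (Finset.mem_Icc.mp j.2).2)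
        (Tensor.psym ((vpow (j : ℕ) v).outer ((Ct - Cb).fixMany s (j : ℕ))))

/-- The coefficient array of the `q`-th derivative of `f : ℝ^n → ℝ`
(domain given the sup-norm product structure). -/
def derivTensorPi {n : ℕ} (q : ℕ) (f : (Fin n → ℝ) → ℝ) (x : Fin n → ℝ) : Tensor n q :=
  fun idx => iteratedFDeriv ℝ q f x (fun k => Pi.single (idx k) 1)

/-- The coefficient array of the `q`-th derivative of `f : ℝ^n → ℝ`
(domain given the Euclidean structure). -/
def derivTensorE {n : ℕ} (q : ℕ) (f : EuclideanSpace ℝ (Fin n) → ℝ)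
    (x : EuclideanSpace ℝ (Fin n)) : Tensor n q :=
  fun idx => iteratedFDeriv ℝ q f x (fun k => EuclideanSpace.single (idx k) 1)

/-- Reinterpret a Euclidean vector as a plain vector in `Fin n → ℝ`. -/
def toVec {n : ℕ} (y : EuclideanSpace ℝ (Fin n)) : Fin n → ℝ := y

section IteratedFDerivSymm

variable {E F : Type*} [NormedAddCommGroup E] [NormedSpace ℝ E] [NormedAddCommGroup F]
  [NormedSpace ℝ F]

theorem ContDiff.differentiable_iteratedFDeriv_nat {f : E → F} {q : ℕ}
    (hf : ContDiff ℝ (q + 1 : ℕ) f) : Differentiable ℝ (iteratedFDeriv ℝ q f) :=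
  hf.differentiable_iteratedFDeriv (by exact_mod_cast Nat.lt_succ_self q)

/-- The two outermost arguments of an iterated derivative can be exchanged. -/
theorem ContDiff.iteratedFDeriv_comp_swap_zero_one {f : E → F} {q : ℕ}
    (hf : ContDiff ℝ (q + 2 : ℕ) f) (x : E) (v : Fin (q + 2) → E) :
    iteratedFDeriv ℝ (q + 2) f x (v ∘ Equiv.swap 0 1) = iteratedFDeriv ℝ (q + 2) f x v := by
  have hg : ContDiff ℝ 2 (iteratedFDeriv ℝ q f) :=
    hf.iteratedFDeriv_right (m := 2) (i := q) (by push_cast; rw [add_comm])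
  have hd : DifferentiableAt ℝ (fderiv ℝ (iteratedFDeriv ℝ q f)) x :=
    (hg.fderiv_right (m := 1) (by norm_num)).differentiable (by norm_num) x
  have hsymm : IsSymmSndFDerivAt ℝ (iteratedFDeriv ℝ q f) x :=
    hg.contDiffAt.isSymmSndFDerivAt (by simp)
  have key : ∀ w : Fin (q + 2) → E, iteratedFDeriv ℝ (q + 2) f x w =
      fderiv ℝ (fderiv ℝ (iteratedFDeriv ℝ q f)) x (w 0) (w 1) (Fin.tail (Fin.tail w)) := by
    intro w
    rw [iteratedFDeriv_succ_apply_left]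
    rw [← fderiv_continuousMultilinear_apply_const_apply
      (hf.differentiable_iteratedFDeriv_nat x)]
    simp only [iteratedFDeriv_succ_apply_left]
    rw [fderiv_continuousMultilinear_apply_const_apply
      (hd.clm_apply (differentiableAt_const _)), fderiv_clm_apply hd (differentiableAt_const _)]
    simp [Fin.tail]
  rw [key, key, hsymm.eq]
  congr 1

/-- Adjacent arguments of an iterated derivative can be exchanged. -/
theorem ContDiff.iteratedFDeriv_comp_swap_castSucc_succ {f : E → F} {q : ℕ}
    (hf : ContDiff ℝ (q + 1 : ℕ) f) (x : E) (i : Fin q) (v : Fin (q + 1) → E) :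
    iteratedFDeriv ℝ (q + 1) f x (v ∘ Equiv.swap i.castSucc i.succ) =
      iteratedFDeriv ℝ (q + 1) f x v := by
  induction q generalizing x with
  | zero => exact i.elim0
  | succ q ih =>
    cases i using Fin.cases with
    | zero => exact hf.iteratedFDeriv_comp_swap_zero_one x v
    | succ j =>
      have happ : ∀ (m : Fin (q + 1) → E) (u : E),
          fderiv ℝ (iteratedFDeriv ℝ (q + 1) f) x u m =
            fderiv ℝ (fun y => iteratedFDeriv ℝ (q + 1) f y m) x u := fun m u => by
        rw [fderiv_continuousMultilinear_apply_const_apply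
          (hf.differentiable_iteratedFDeriv_nat x)]
      have htail : Fin.tail (v ∘ Equiv.swap j.succ.castSucc j.succ.succ) =
          Fin.tail v ∘ Equiv.swap j.castSucc j.succ := by
        funext k
        simp only [Fin.tail, Function.comp_apply]
        rw [← Fin.succ_castSucc, (Fin.succ_injective (q + 1)).swap_apply]
      have hzero : (v ∘ Equiv.swap j.succ.castSucc j.succ.succ) 0 = v 0 := by
        rw [Function.comp_apply, ← Fin.succ_castSucc,
          Equiv.swap_apply_of_ne_of_ne (Fin.succ_ne_zero _).symm (Fin.succ_ne_zero _).symm]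
      rw [iteratedFDeriv_succ_apply_left, iteratedFDeriv_succ_apply_left, htail, hzero, happ,
        happ]
      simp only [ih (hf.of_le (by exact_mod_cast Nat.le_succ (q + 1)))]

/-- The `q`-th iterated derivative of a function of class `C^q` is symmetric. -/
theorem ContDiff.iteratedFDeriv_comp_perm_of_nat {f : E → F} {q : ℕ} (hf : ContDiff ℝ q f)
    (x : E) (v : Fin q → E) (σ : Equiv.Perm (Fin q)) :
    iteratedFDeriv ℝ q f x (v ∘ σ) = iteratedFDeriv ℝ q f x v := by
  cases q with
  | zero => rw [Subsingleton.elim (v ∘ σ) v]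
  | succ q =>
    have hσ : σ ∈ Submonoid.closure
        (Set.range fun i : Fin q => Equiv.swap i.castSucc i.succ) := by
      rw [Equiv.Perm.mclosure_swap_castSucc_succ]
      trivial
    induction hσ using Submonoid.closure_induction generalizing v with
    | mem τ hτ =>
      obtain ⟨i, rfl⟩ := hτ
      exact hf.iteratedFDeriv_comp_swap_castSucc_succ x i v
    | one => rfl
    | mul τ ρ _ _ hτ hρ => rw [Equiv.Perm.coe_mul, ← Function.comp_assoc, hρ, hτ]

end IteratedFDerivSymm

/-- A nonnegative sequence with `e (k + 1) ≤ (1 + a k) * e k + b k` for summable perturbations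
`a` and `b` converges. -/
theorem exists_tendsto_of_le_one_add_mul_add {e a b : ℕ → ℝ} (he : ∀ k, 0 ≤ e k)
    (ha : ∀ k, 0 ≤ a k) (hb : ∀ k, 0 ≤ b k) (hasum : Summable a) (hbsum : Summable b)
    (h : ∀ k, e (k + 1) ≤ (1 + a k) * e k + b k) : ∃ l, Tendsto e atTop (nhds l) := by
  have hbound : ∀ k, e k ≤
      Real.exp (∑ j ∈ Finset.range k, a j) * (e 0 + ∑ j ∈ Finset.range k, b j) := by
    intro k
    induction k with
    | zero => simp
    | succ k ih =>
      set α := ∑ j ∈ Finset.range k, a j with hα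
      set β := ∑ j ∈ Finset.range k, b j with hβ
      have hαpos : 0 ≤ α := Finset.sum_nonneg fun j _ => ha j
      rw [Finset.sum_range_succ, Finset.sum_range_succ, ← hα, ← hβ, ← add_assoc, mul_add]
      have h₁ : (1 + a k) * e k ≤ Real.exp (α + a k) * (e 0 + β) := by
        rw [Real.exp_add, mul_comm (Real.exp α), mul_assoc]
        refine mul_le_mul ?_ ih (he k) (Real.exp_pos _).le
        rw [add_comm]
        exact Real.add_one_le_exp _
      have h₂ : b k ≤ Real.exp (α + a k) * b k :=
        le_mul_of_one_le_left (hb k) (Real.one_le_exp (add_nonneg hαpos (ha k)))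
      linarith [h k]
  set M := Real.exp (∑' j, a j) * (e 0 + ∑' j, b j) with hM
  have heM : ∀ k, e k ≤ M := fun k => by
    refine (hbound k).trans (mul_le_mul ?_ ?_ ?_ (Real.exp_pos _).le)
    · exact Real.exp_le_exp.2 (hasum.sum_le_tsum _ fun j _ => ha j)
    · linarith [hbsum.sum_le_tsum (Finset.range k) fun j _ => hb j]
    · exact add_nonneg (he 0) (Finset.sum_nonneg fun j _ => hb j)
  have hcsum : Summable fun k => a k * M + b k := (hasum.mul_right M).add hbsum
  have hanti : Antitone fun k => e k - ∑ j ∈ Finset.range k, (a j * M + b j) := by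
    refine antitone_nat_of_succ_le fun k => ?_
    rw [Finset.sum_range_succ]
    nlinarith [h k, mul_le_mul_of_nonneg_left (heM k) (ha k)]
  have hbdd : BddBelow (Set.range fun k => e k - ∑ j ∈ Finset.range k, (a j * M + b j)) := by
    refine ⟨-∑' j, (a j * M + b j), ?_⟩
    rintro _ ⟨k, rfl⟩
    have := hcsum.sum_le_tsum (Finset.range k) fun j _ =>
      add_nonneg (mul_nonneg (ha j) ((he 0).trans (heM 0))) (hb j)
    simp only
    linarith [he k]
  refine ⟨_, ((tendsto_atTop_ciInf hanti hbdd).add hcsum.hasSum.tendsto_sum_nat).congr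
    fun k => ?_⟩
  ring

/-- Bounded deterioration together with the Pythagorean decrease of a least-change update forces
the update steps to vanish. -/
theorem tendsto_update_sub_of_pythagorean {E F : Type*} [NormedAddCommGroup E] [NormedSpace ℝ E]
    [NormedAddCommGroup F] [NormedSpace ℝ F] {A : ℕ → E →L[ℝ] F} {Ast : E →L[ℝ] F} {c : ℝ}
    (hc : 0 ≤ c) (hAst : ∀ T, ‖T‖ ≤ c * ‖Ast T‖) (hA : Summable fun k => ‖A k - Ast‖)
    {C G : ℕ → E} {Cst : E} (hG : Summable fun k => ‖G k - Cst‖)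
    (h : ∀ k, ‖A k (C (k + 1) - C k)‖ ^ 2 + ‖A k (C (k + 1) - G k)‖ ^ 2 ≤
      ‖A k (C k - G k)‖ ^ 2) :
    Tendsto (fun k => C (k + 1) - C k) atTop (nhds 0) := by
  set m := ‖Ast‖ with hm
  have hm0 : 0 ≤ m := norm_nonneg _
  set d : ℕ → ℝ := fun k => c * ‖A k - Ast‖ with hd
  have hd0 : ∀ k, 0 ≤ d k := fun k => mul_nonneg hc (norm_nonneg _)
  have hdsum : Summable d := hA.mul_left c
  have hdiff : ∀ k T, ‖A k T - Ast T‖ ≤ d k * ‖Ast T‖ := fun k T => by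
    have h₁ : ‖A k T - Ast T‖ ≤ ‖A k - Ast‖ * ‖T‖ := (A k - Ast).le_opNorm T
    have h₂ := mul_le_mul_of_nonneg_left (hAst T) (norm_nonneg (A k - Ast))
    calc _ ≤ _ := h₁
      _ ≤ _ := h₂
      _ = d k * ‖Ast T‖ := by rw [hd]; ring
  have hup : ∀ k T, ‖A k T‖ ≤ (1 + d k) * ‖Ast T‖ := fun k T => by
    linarith [hdiff k T, norm_le_norm_add_norm_sub' (A k T) (Ast T)]
  have hlow : ∀ k T, ‖Ast T‖ ≤ ‖A k T‖ + d k * ‖Ast T‖ := fun k T => by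
    linarith [hdiff k T, norm_le_norm_add_norm_sub (A k T) (Ast T)]
  set ε : ℕ → ℝ := fun k => m * ‖G k - Cst‖ with hε
  have hε0 : ∀ k, 0 ≤ ε k := fun k => mul_nonneg hm0 (norm_nonneg _)
  have hεsum : Summable ε := hG.mul_left m
  have hGε : ∀ k, ‖Ast (G k - Cst)‖ ≤ ε k := fun k => Ast.le_opNorm _
  set e : ℕ → ℝ := fun k => ‖Ast (C k - Cst)‖ with he
  have he₁ : ∀ j k, |‖Ast (C j - G k)‖ - e j| ≤ ε k := fun j k => by
    refine (abs_norm_sub_norm_le _ _).trans ?_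
    rw [← map_sub, sub_sub_sub_cancel_left, ← neg_sub, map_neg, norm_neg]
    exact hGε k
  have hdec : ∀ k, ‖A k (C (k + 1) - G k)‖ ≤ ‖A k (C k - G k)‖ := fun k =>
    le_of_sq_le_sq (by nlinarith [h k, sq_nonneg ‖A k (C (k + 1) - C k)‖]) (norm_nonneg _)
  obtain ⟨K, hK⟩ := eventually_atTop.1
    (hdsum.tendsto_atTop_zero.eventually (gt_mem_nhds (show (0 : ℝ) < 1 / 2 by norm_num)))
  have hlow' : ∀ k ≥ K, ∀ T, ‖Ast T‖ ≤ (1 + 2 * d k) * ‖A k T‖ := fun k hk T => by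
    have h₁ := hlow k T
    have h₂ := hK k hk
    have h₃ : ‖Ast T‖ ≤ 2 * ‖A k T‖ := by nlinarith [norm_nonneg (Ast T)]
    nlinarith [hd0 k, mul_le_mul_of_nonneg_left h₃ (hd0 k)]
  have hrec : ∀ k ≥ K, e (k + 1) ≤ (1 + 4 * d k) * e k + 4 * ε k := fun k hk => by
    have h₁ := hlow' k hk (C (k + 1) - G k)
    have h₂ := hup k (C k - G k)
    have h₃ := (abs_le.1 (he₁ (k + 1) k)).1
    have h₄ := (abs_le.1 (he₁ k k)).2
    have hd2 := hK k hk
    have h₅ : (1 + d k) * ‖Ast (C k - G k)‖ ≤ (1 + d k) * (e k + ε k) :=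
      mul_le_mul_of_nonneg_left (by linarith) (by linarith [hd0 k])
    have h₆ : (1 + 2 * d k) * ‖A k (C (k + 1) - G k)‖ ≤
        (1 + 2 * d k) * ((1 + d k) * (e k + ε k)) :=
      mul_le_mul_of_nonneg_left (by linarith [hdec k]) (by linarith [hd0 k])
    have h₇ : (1 + 2 * d k) * (1 + d k) ≤ 1 + 4 * d k := by nlinarith [hd0 k]
    have h₈ := mul_le_mul_of_nonneg_right h₇
      (add_nonneg (norm_nonneg (Ast (C k - Cst))) (hε0 k))
    have h₉ := mul_le_mul_of_nonneg_right hd2.le (hε0 k)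
    nlinarith
  obtain ⟨l, hl⟩ : ∃ l, Tendsto e atTop (nhds l) := by
    obtain ⟨l, hl⟩ := exists_tendsto_of_le_one_add_mul_add (e := fun k => e (k + K))
      (a := fun k => 4 * d (k + K)) (b := fun k => 4 * ε (k + K)) (fun k => norm_nonneg _)
      (fun k => mul_nonneg (by norm_num) (hd0 _)) (fun k => mul_nonneg (by norm_num) (hε0 _))
      (((summable_nat_add_iff K).2 hdsum).mul_left 4)
      (((summable_nat_add_iff K).2 hεsum).mul_left 4)
      (fun k => by
        have := hrec (k + K) (Nat.le_add_left K k)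
        rwa [Nat.add_right_comm] at this)
    exact ⟨l, (tendsto_add_atTop_iff_nat K).1 hl⟩
  have hweight : ∀ T : ℕ → E, Tendsto (fun k => ‖Ast (T k)‖) atTop (nhds l) →
      Tendsto (fun k => ‖A k (T k)‖) atTop (nhds l) := fun T hT => by
    have h₀ : Tendsto (fun k => d k * ‖Ast (T k)‖) atTop (nhds 0) := by
      simpa using hdsum.tendsto_atTop_zero.mul hT
    have h₁ : Tendsto (fun k => ‖A k (T k)‖ - ‖Ast (T k)‖) atTop (nhds 0) :=
      squeeze_zero_norm
        (fun k => (abs_norm_sub_norm_le (A k (T k)) (Ast (T k))).trans (hdiff k (T k))) h₀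
    simpa using h₁.add hT
  have hshift : ∀ j : ℕ → ℕ, Tendsto j atTop atTop →
      Tendsto (fun k => ‖Ast (C (j k) - G k)‖) atTop (nhds l) := fun j hj => by
    have h₁ : Tendsto (fun k => ‖Ast (C (j k) - G k)‖ - e (j k)) atTop (nhds 0) :=
      squeeze_zero_norm (fun k => he₁ (j k) k) hεsum.tendsto_atTop_zero
    simpa using h₁.add (hl.comp hj)
  have hα := hweight _ (hshift (fun k => k) tendsto_id)
  have hβ := hweight _ (hshift (fun k => k + 1) (tendsto_add_atTop_nat 1))
  have hu2 : Tendsto (fun k => ‖A k (C (k + 1) - C k)‖ ^ 2) atTop (nhds 0) := by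
    have h₁ := (hα.pow 2).sub (hβ.pow 2)
    rw [sub_self] at h₁
    exact squeeze_zero (fun k => sq_nonneg _) (fun k => by linarith [h k]) h₁
  have hu : Tendsto (fun k => ‖A k (C (k + 1) - C k)‖) atTop (nhds 0) := by
    simpa [Real.sqrt_sq (norm_nonneg _)] using hu2.sqrt
  refine squeeze_zero_norm' (a := fun k => c * (2 * ‖A k (C (k + 1) - C k)‖)) ?_
    (by simpa using (hu.const_mul 2).const_mul c)
  filter_upwards [eventually_ge_atTop K] with k hk
  refine (hAst _).trans (mul_le_mul_of_nonneg_left ?_ hc)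
  refine (hlow' k hk _).trans (mul_le_mul_of_nonneg_right ?_ (norm_nonneg _))
  linarith [hK k hk]

/-- A vector of least norm on a line is orthogonal to the line. -/
theorem inner_eq_zero_of_forall_norm_le_norm_add_smul {E : Type*} [NormedAddCommGroup E]
    [InnerProductSpace ℝ E] {a b : E} (h : ∀ t : ℝ, ‖a‖ ≤ ‖a + t • b‖) : inner ℝ a b = 0 := by
  have hexp : ∀ t : ℝ, 0 ≤ 2 * (t * inner ℝ a b) + t ^ 2 * ‖b‖ ^ 2 := fun t => by
    have h₁ := pow_le_pow_left₀ (norm_nonneg a) (h t) 2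
    rw [norm_add_sq_real, inner_smul_right, norm_smul, mul_pow, Real.norm_eq_abs, sq_abs] at h₁
    linarith
  by_contra hne
  have hb : 0 < ‖b‖ ^ 2 := by
    have : b ≠ 0 := fun hb => hne (by rw [hb, inner_zero_right])
    positivity
  have h₁ := hexp (-inner ℝ a b / ‖b‖ ^ 2)
  have h₂ : 2 * (-inner ℝ a b / ‖b‖ ^ 2 * inner ℝ a b) +
      (-inner ℝ a b / ‖b‖ ^ 2) ^ 2 * ‖b‖ ^ 2 = -(inner ℝ a b ^ 2 / ‖b‖ ^ 2) := by
    field_simp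
    ring
  rw [h₂] at h₁
  have : 0 < inner ℝ a b ^ 2 / ‖b‖ ^ 2 := by positivity
  linarith

theorem summable_abs_mul_sub_mul {a b : ℕ → ℝ} {a₀ b₀ : ℝ} (ha : Summable fun k => |a k - a₀|)
    (hb : Summable fun k => |b k - b₀|) : Summable fun k => |a k * b k - a₀ * b₀| := by
  have hbound : ∀ k, |a k| ≤ |a₀| + ∑' j, |a j - a₀| := fun k => by
    have h₁ := ha.le_tsum k fun j _ => abs_nonneg _
    have h₂ : |a k| ≤ |a₀| + |a k - a₀| := by
      simpa using abs_add_le a₀ (a k - a₀)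
    linarith
  refine Summable.of_nonneg_of_le (fun k => abs_nonneg _) (fun k => ?_)
    ((hb.mul_left (|a₀| + ∑' j, |a j - a₀|)).add (ha.mul_right |b₀|))
  calc |a k * b k - a₀ * b₀| = |a k * (b k - b₀) + (a k - a₀) * b₀| := by ring_nf
    _ ≤ |a k| * |b k - b₀| + |a k - a₀| * |b₀| := by
      rw [← abs_mul, ← abs_mul]
      exact abs_add_le _ _
    _ ≤ _ := by gcongr; exact hbound k

theorem summable_abs_prod_sub_prod {ι : Type*} (s : Finset ι) {a : ℕ → ι → ℝ} {a₀ : ι → ℝ}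
    (ha : ∀ i, Summable fun k => |a k i - a₀ i|) :
    Summable fun k => |∏ i ∈ s, a k i - ∏ i ∈ s, a₀ i| := by
  classical
  induction s using Finset.induction_on with
  | empty => simp
  | insert i s hi ih =>
    simp only [Finset.prod_insert hi]
    exact summable_abs_mul_sub_mul (ha i) ih

namespace Tensor

theorem frobNorm_eq_norm {n q : ℕ} (T : Tensor n q) : T.frobNorm = ‖WithLp.toLp 2 T‖ := by
  simp [frobNorm, EuclideanSpace.norm_eq]

theorem fixMany_one_apply {n q : ℕ} (T : Tensor n (q + 1)) (s : Fin n → ℝ) (idx : Fin q → Fin n) :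
    T.fixMany s 1 idx = ∑ a, s a * T (Fin.cons a idx) := by
  refine Fintype.sum_equiv (Equiv.funUnique (Fin 1) (Fin n)) _ _ fun i => ?_
  rw [Fin.prod_univ_one]
  congr 2
  funext k
  cases k using Fin.cases with
  | zero => rfl
  | succ k => simp

theorem fixMany_one_sub {n q : ℕ} (T S : Tensor n (q + 1)) (s : Fin n → ℝ) :
    (T - S).fixMany s 1 = T.fixMany s 1 - S.fixMany s 1 := by
  funext idx
  rw [Pi.sub_apply]
  erw [fixMany_one_apply, fixMany_one_apply, fixMany_one_apply]
  simp [mul_sub]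

theorem fixMany_one_add_smul_sub {n q : ℕ} {T S : Tensor n (q + 1)} {s : Fin n → ℝ}
    (h : T.fixMany s 1 = S.fixMany s 1) (t : ℝ) :
    (T + t • (T - S)).fixMany s 1 = T.fixMany s 1 := by
  funext idx
  have h₁ := congrFun (fixMany_one_sub T S s) idx
  rw [h, sub_self] at h₁
  erw [fixMany_one_apply] at h₁ ⊢
  erw [fixMany_one_apply]
  simp only [Pi.add_apply, Pi.smul_apply, smul_eq_mul, mul_add, mul_left_comm _ t,
    Finset.sum_add_distrib, ← Finset.mul_sum, h₁]
  simp

theorem frobNorm_fixMany_one_le {n q : ℕ} (T : Tensor n (q + 1)) (s : Fin n → ℝ) :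
    (T.fixMany s 1).frobNorm ≤ T.frobNorm * vnorm s := by
  rw [frobNorm, frobNorm, vnorm, ← Real.sqrt_mul (by positivity)]
  refine Real.sqrt_le_sqrt ?_
  calc ∑ idx : Fin q → Fin n, (T.fixMany s 1 idx) ^ 2
      ≤ ∑ idx : Fin q → Fin n, (∑ a, s a ^ 2) * ∑ a, T (Fin.cons a idx) ^ 2 := by
        refine Finset.sum_le_sum fun idx _ => ?_
        erw [fixMany_one_apply]
        exact Finset.sum_mul_sq_le_sq_mul_sq _ _ _
    _ = (∑ i, T i ^ 2) * ∑ a, s a ^ 2 := by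
        rw [← Finset.mul_sum, mul_comm, Finset.sum_comm, ← Fintype.sum_prod_type']
        congr 1
        exact Fintype.sum_equiv (Fin.consEquiv fun _ => Fin n) _ _ fun _ => rfl

/-- The matrix of the linear map `T ↦ T[W]^q` on coefficient arrays. -/
def multiMatrix {n : ℕ} (q : ℕ) (W : Matrix (Fin n) (Fin n) ℝ) :
    Matrix (Fin q → Fin n) (Fin q → Fin n) ℝ :=
  Matrix.of fun j i => ∏ k, W (i k) (j k)

theorem toLp_applyMat {n q : ℕ} (T : Tensor n q) (W : Matrix (Fin n) (Fin n) ℝ) :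
    WithLp.toLp 2 (T.applyMat W) =
      Matrix.toEuclideanCLM (𝕜 := ℝ) (multiMatrix q W) (WithLp.toLp 2 T) := by
  rw [Matrix.toEuclideanCLM_toLp]
  congr 1
  funext j
  exact Finset.sum_congr rfl fun i _ => mul_comm _ _

theorem multiMatrix_mul {n : ℕ} (q : ℕ) (V W : Matrix (Fin n) (Fin n) ℝ) :
    multiMatrix q V * multiMatrix q W = multiMatrix q (W * V) := by
  ext j i
  simp only [multiMatrix, Matrix.mul_apply, Matrix.of_apply, Finset.prod_univ_sum,
    Fintype.piFinset_univ, ← Finset.prod_mul_distrib]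
  exact Finset.sum_congr rfl fun l _ => Finset.prod_congr rfl fun k _ => mul_comm _ _

theorem multiMatrix_one {n : ℕ} (q : ℕ) :
    multiMatrix q (1 : Matrix (Fin n) (Fin n) ℝ) = 1 := by
  ext j i
  simp only [multiMatrix, Matrix.of_apply, Matrix.one_apply, Fintype.prod_boole, funext_iff,
    eq_comm]
  congr

theorem norm_le_mul_norm_multiMatrix {n q : ℕ} {W : Matrix (Fin n) (Fin n) ℝ}
    (hW : IsUnit W.det) (T : EuclideanSpace ℝ (Fin q → Fin n)) :
    ‖T‖ ≤ ‖Matrix.toEuclideanCLM (𝕜 := ℝ) (multiMatrix q W⁻¹)‖ *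
      ‖Matrix.toEuclideanCLM (𝕜 := ℝ) (multiMatrix q W) T‖ := by
  refine le_of_eq_of_le ?_ (ContinuousLinearMap.le_opNorm _ _)
  rw [← mul_apply_eq_comp, ← map_mul, multiMatrix_mul, Matrix.mul_nonsing_inv _ hW,
    multiMatrix_one, map_one, one_apply_eq_self]

end Tensor

theorem abs_apply_le_specNorm {n : ℕ} (M : Matrix (Fin n) (Fin n) ℝ) (i j : Fin n) :
    |M i j| ≤ specNorm M := by
  have h₁ : M i j = Matrix.toEuclideanCLM (𝕜 := ℝ) M (EuclideanSpace.single j 1) i := by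
    simp [Matrix.ofLp_toEuclideanCLM]
  rw [h₁, ← Real.norm_eq_abs]
  refine (PiLp.norm_apply_le _ i).trans ((ContinuousLinearMap.le_opNorm _ _).trans ?_)
  simp [specNorm]

theorem summable_norm_toEuclideanCLM {ι : Type*} [Fintype ι] [DecidableEq ι]
    {M : ℕ → Matrix ι ι ℝ} (h : ∀ i j, Summable fun k => |M k i j|) :
    Summable fun k => ‖Matrix.toEuclideanCLM (𝕜 := ℝ) (M k)‖ := by
  refine Summable.of_nonneg_of_le (fun k => norm_nonneg _) (fun k => ?_)
    (summable_sum fun i (_ : i ∈ Finset.univ) => summable_sum fun j (_ : j ∈ Finset.univ) =>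
      (h i j).mul_right ‖Matrix.toEuclideanCLM (𝕜 := ℝ) (Matrix.single i j (1 : ℝ))‖)
  conv_lhs => rw [Matrix.matrix_eq_sum_single (M k)]
  rw [map_sum]
  refine (norm_sum_le _ _).trans (Finset.sum_le_sum fun i _ => ?_)
  rw [map_sum]
  refine (norm_sum_le _ _).trans (Finset.sum_le_sum fun j _ => ?_)
  rw [← mul_one (M k i j), ← smul_eq_mul, ← Matrix.smul_single, map_smul, norm_smul]
  simp

theorem summable_norm_multiMatrix_sub {n : ℕ} (q : ℕ) {W : ℕ → Matrix (Fin n) (Fin n) ℝ}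
    {Wst : Matrix (Fin n) (Fin n) ℝ} (h : Summable fun k => specNorm (W k - Wst)) :
    Summable fun k => ‖Matrix.toEuclideanCLM (𝕜 := ℝ) (Tensor.multiMatrix q (W k)) -
      Matrix.toEuclideanCLM (𝕜 := ℝ) (Tensor.multiMatrix q Wst)‖ := by
  simp only [← map_sub]
  refine summable_norm_toEuclideanCLM fun j i => ?_
  refine summable_abs_prod_sub_prod (a := fun k l => W k (i l) (j l)) Finset.univ fun l => ?_
  exact h.of_nonneg_of_le (fun k => abs_nonneg _) fun k => abs_apply_le_specNorm (W k - Wst) _ _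

/-- A least-change update is the orthogonal projection onto the symmetric solutions of the secant
equation, hence satisfies the Pythagorean identity. -/
theorem IsSecantUpdate.pythagorean {n q : ℕ} {Cb Cp G : Tensor n (q + 1)} {R : Tensor n q}
    {W : Matrix (Fin n) (Fin n) ℝ} {s : Fin n → ℝ} (h : IsSecantUpdate Cb R W s Cp)
    (hG : G.Symm) (hGs : G.fixMany s 1 = R) :
    ((Cp - Cb).applyMat W).frobNorm ^ 2 + ((Cp - G).applyMat W).frobNorm ^ 2 =
      ((Cb - G).applyMat W).frobNorm ^ 2 := by
  obtain ⟨hsymm, hsec, hmin⟩ := h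
  simp only [Tensor.frobNorm_eq_norm, Tensor.toLp_applyMat] at hmin ⊢
  set A := Matrix.toEuclideanCLM (𝕜 := ℝ) (Tensor.multiMatrix (q + 1) W)
  have horth : inner ℝ (A (WithLp.toLp 2 (Cp - Cb))) (A (WithLp.toLp 2 (Cp - G))) = 0 := by
    refine inner_eq_zero_of_forall_norm_le_norm_add_smul fun t => ?_
    rw [← map_smul, ← map_add, ← WithLp.toLp_smul, ← WithLp.toLp_add]
    have hfeas := hmin (Cp + t • (Cp - G))
      (fun σ i => by simp [hsymm σ i, hG σ i])
      ((Tensor.fixMany_one_add_smul_sub (hsec.trans hGs.symm) t).trans hsec)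
    rwa [add_sub_right_comm] at hfeas
  have hsplit : A (WithLp.toLp 2 (Cb - G)) =
      A (WithLp.toLp 2 (Cp - G)) - A (WithLp.toLp 2 (Cp - Cb)) := by
    rw [← map_sub, ← WithLp.toLp_sub, sub_sub_sub_cancel_left]
  rw [hsplit, norm_sub_sq_real, real_inner_comm, horth]
  ring

theorem Tensor.symm_derivTensorE {n q : ℕ} {f : EuclideanSpace ℝ (Fin n) → ℝ}
    (hf : ContDiff ℝ q f) (x : EuclideanSpace ℝ (Fin n)) : (derivTensorE q f x).Symm :=
  fun σ i => hf.iteratedFDeriv_comp_perm_of_nat x (fun k => EuclideanSpace.single (i k) 1) σ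

theorem abs_derivTensorE_sub_le {n q : ℕ} (f : EuclideanSpace ℝ (Fin n) → ℝ)
    (x y : EuclideanSpace ℝ (Fin n)) (idx : Fin q → Fin n) :
    |derivTensorE q f x idx - derivTensorE q f y idx| ≤
      ‖iteratedFDeriv ℝ q f x - iteratedFDeriv ℝ q f y‖ := by
  have h := (iteratedFDeriv ℝ q f x - iteratedFDeriv ℝ q f y).le_opNorm
    fun k => EuclideanSpace.single (idx k) 1
  simpa [derivTensorE] using h

theorem continuous_derivTensorE {n q : ℕ} {f : EuclideanSpace ℝ (Fin n) → ℝ}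
    (hf : ContDiff ℝ q f) (idx : Fin q → Fin n) :
    Continuous fun x => derivTensorE q f x idx :=
  (hf.continuous_iteratedFDeriv le_rfl).eval_const _

theorem fixMany_one_derivTensorE {n q : ℕ} (f : EuclideanSpace ℝ (Fin n) → ℝ)
    (x s : EuclideanSpace ℝ (Fin n)) (idx : Fin q → Fin n) :
    (derivTensorE (q + 1) f x).fixMany (toVec s) 1 idx =
      fderiv ℝ (iteratedFDeriv ℝ q f) x s fun k => EuclideanSpace.single (idx k) 1 := by
  erw [Tensor.fixMany_one_apply]
  have hs : s = ∑ a, s a • EuclideanSpace.single a (1 : ℝ) := by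
    ext b
    simp [Finset.sum_apply, Pi.single_apply]
  conv_rhs => rw [hs]
  rw [map_sum, _root_.sum_apply]
  refine Finset.sum_congr rfl fun a _ => ?_
  rw [map_smul, _root_.smul_apply, smul_eq_mul, derivTensorE,
    iteratedFDeriv_succ_apply_left]
  rfl

/-- The mean value of the derivative tensor over a segment satisfies the secant equation. -/
theorem exists_symm_secant_tensor {n q : ℕ} {f : EuclideanSpace ℝ (Fin n) → ℝ}
    (hf : ContDiff ℝ (q + 1 : ℕ) f) {L : NNReal}
    (hL : LipschitzWith L (iteratedFDeriv ℝ (q + 1) f)) (xst y z : EuclideanSpace ℝ (Fin n)) :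
    ∃ G : Tensor n (q + 1), G.Symm ∧
      G.fixMany (toVec (z - y)) 1 = derivTensorE q f z - derivTensorE q f y ∧
      ∀ idx, |G idx - derivTensorE (q + 1) f xst idx| ≤ L * (‖y - xst‖ + ‖z - xst‖) := by
  have hcont : ∀ idx, Continuous fun t : ℝ =>
      derivTensorE (q + 1) f (y + t • (z - y)) idx := fun idx =>
    (continuous_derivTensorE hf idx).comp (by fun_prop)
  refine ⟨fun idx => ∫ t in (0 : ℝ)..1, derivTensorE (q + 1) f (y + t • (z - y)) idx,
    fun σ i => ?_, ?_, fun idx => ?_⟩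
  · simp only [Tensor.symm_derivTensorE hf _ σ i]
  · funext idx
    erw [Tensor.fixMany_one_apply]
    simp only [← intervalIntegral.integral_const_mul]
    rw [← intervalIntegral.integral_finsetSum fun a _ =>
      ((hcont _).const_mul _).intervalIntegrable _ _]
    have hsum : ∀ t : ℝ, ∑ a, toVec (z - y) a *
        derivTensorE (q + 1) f (y + t • (z - y)) (Fin.cons a idx) =
          fderiv ℝ (iteratedFDeriv ℝ q f) (y + t • (z - y)) (z - y)
            fun k => EuclideanSpace.single (idx k) 1 := fun t =>
      (Tensor.fixMany_one_apply _ _ _).symm.trans (fixMany_one_derivTensorE f _ _ idx)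
    have hder : ∀ t : ℝ, HasDerivAt (fun t : ℝ => derivTensorE q f (y + t • (z - y)) idx)
        (∑ a, toVec (z - y) a *
          derivTensorE (q + 1) f (y + t • (z - y)) (Fin.cons a idx)) t := fun t => by
      rw [hsum]
      have hline : HasDerivAt (fun t : ℝ => y + t • (z - y)) (z - y) t := by
        simpa using ((hasDerivAt_id t).smul_const (z - y)).const_add y
      have hD := ((hf.differentiable_iteratedFDeriv_nat _).hasFDerivAt.comp_hasDerivAt t hline)
      exact (ContinuousMultilinearMap.apply ℝ (fun _ : Fin q => EuclideanSpace ℝ (Fin n)) ℝ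
        fun k => EuclideanSpace.single (idx k) 1).hasFDerivAt.comp_hasDerivAt t hD
    rw [intervalIntegral.integral_eq_sub_of_hasDerivAt (fun t _ => hder t)
      ((continuous_finsetSum _ fun a _ => (hcont _).const_mul _).intervalIntegrable _ _)]
    simp
  · have hsub : (∫ t in (0 : ℝ)..1, derivTensorE (q + 1) f (y + t • (z - y)) idx) -
        derivTensorE (q + 1) f xst idx = ∫ t in (0 : ℝ)..1,
          (derivTensorE (q + 1) f (y + t • (z - y)) idx - derivTensorE (q + 1) f xst idx) := by
      rw [intervalIntegral.integral_sub ((hcont idx).intervalIntegrable _ _)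
        (by simp)]
      simp
    rw [hsub, ← Real.norm_eq_abs]
    refine (intervalIntegral.norm_integral_le_of_norm_le_const
      (C := L * (‖y - xst‖ + ‖z - xst‖)) fun t ht => ?_).trans (by simp)
    rw [Set.uIoc_of_le zero_le_one] at ht
    refine (abs_derivTensorE_sub_le f _ _ idx).trans ((hL.norm_sub_le _ _).trans ?_)
    refine mul_le_mul_of_nonneg_left ?_ L.2
    have hconv : y + t • (z - y) - xst = (1 - t) • (y - xst) + t • (z - xst) := by module
    rw [hconv]
    refine (norm_add_le _ _).trans ?_
    rw [norm_smul, norm_smul, Real.norm_of_nonneg ht.1.le,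
      Real.norm_of_nonneg (sub_nonneg.2 ht.2)]
    nlinarith [norm_nonneg (y - xst), norm_nonneg (z - xst), ht.1, ht.2]

theorem norm_toLp_le_sum_abs {ι : Type*} [Fintype ι] (v : ι → ℝ) :
    ‖WithLp.toLp 2 v‖ ≤ ∑ i, |v i| := by
  rw [EuclideanSpace.norm_eq]
  refine Real.sqrt_le_iff.2 ⟨Finset.sum_nonneg fun i _ => abs_nonneg _, ?_⟩
  exact Finset.sum_sq_le_sq_sum_of_nonneg fun i _ => abs_nonneg _

/-- the generalized Dennis–Moré condition
`‖(C_k - D^p f(x_*))[s_k]‖_F / ‖s_k‖₂ → 0` under Lipschitz continuity of `D^p f` and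
summability of `‖x_k - x_*‖` and `‖W_k - W_*‖`. -/
theorem statement14 (n p : ℕ) (hn : 1 ≤ n) (hp : 1 ≤ p)
    (f : EuclideanSpace ℝ (Fin n) → ℝ) (hf : ContDiff ℝ p f)
    (hLip : ∃ L : NNReal, LipschitzWith L (iteratedFDeriv ℝ p f))
    (x : ℕ → EuclideanSpace ℝ (Fin n)) (xst : EuclideanSpace ℝ (Fin n))
    (hx : Tendsto x atTop (nhds xst))
    (hs : ∀ k, x (k + 1) - x k ≠ 0)
    (W : ℕ → Matrix (Fin n) (Fin n) ℝ) (hWk : ∀ k, IsUnit (W k).det)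
    (Wst : Matrix (Fin n) (Fin n) ℝ) (hWst : IsUnit Wst.det)
    (hWlim : Tendsto W atTop (nhds Wst))
    (hxsum : Summable fun k => ‖x k - xst‖)
    (hWsum : Summable fun k => specNorm (W k - Wst))
    (C : ℕ → Tensor n p) (hC0 : (C 0).Symm)
    (hupd : ∀ k, IsSecantUpdate (C k)
      (derivTensorE (p - 1) f (x (k + 1)) - derivTensorE (p - 1) f (x k))
      (W k) (toVec (x (k + 1) - x k)) (C (k + 1))) :
    Tendsto (fun k =>
        ((C k - derivTensorE p f xst).fixMany (toVec (x (k + 1) - x k)) 1).frobNorm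
          / vnorm (toVec (x (k + 1) - x k)))
      atTop (nhds 0) := by
  obtain ⟨L, hL⟩ := hLip
  obtain ⟨q, rfl⟩ : ∃ q, p = q + 1 := ⟨p - 1, (Nat.sub_add_cancel hp).symm⟩
  choose G hGsymm hGsec hGbound using fun k =>
    exists_symm_secant_tensor hf hL xst (x k) (x (k + 1))
  set Cst := derivTensorE (q + 1) f xst
  have hxsum' : Summable fun k => ‖x k - xst‖ + ‖x (k + 1) - xst‖ :=
    hxsum.add ((summable_nat_add_iff 1).2 hxsum)
  have hG : Summable fun k => ‖WithLp.toLp 2 (G k) - WithLp.toLp 2 Cst‖ := by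
    refine Summable.of_nonneg_of_le (fun k => norm_nonneg _) (fun k => ?_)
      (summable_sum (s := Finset.univ) fun (_ : Fin (q + 1) → Fin n) _ =>
        hxsum'.mul_left (L : ℝ))
    rw [← WithLp.toLp_sub]
    exact (norm_toLp_le_sum_abs _).trans (Finset.sum_le_sum fun idx _ => hGbound k idx)
  have hstep := tendsto_update_sub_of_pythagorean (norm_nonneg _)
    (Tensor.norm_le_mul_norm_multiMatrix hWst) (summable_norm_multiMatrix_sub (q + 1) hWsum)
    (C := fun k => WithLp.toLp 2 (C k)) hG fun k => by
      have hk := ((hupd k).pythagorean (hGsymm k) (hGsec k)).le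
      simpa only [Tensor.frobNorm_eq_norm, Tensor.toLp_applyMat, WithLp.toLp_sub] using hk
  have hlim : Tendsto (fun k => (G k - Cst).frobNorm + (C (k + 1) - C k).frobNorm) atTop
      (nhds 0) := by
    simpa [Tensor.frobNorm_eq_norm] using hG.tendsto_atTop_zero.add hstep.norm
  refine squeeze_zero (fun k => div_nonneg (Real.sqrt_nonneg _) (Real.sqrt_nonneg _))
    (fun k => ?_) hlim
  have hsplit : (C k - Cst).fixMany (toVec (x (k + 1) - x k)) 1 =
      (G k - Cst - (C (k + 1) - C k)).fixMany (toVec (x (k + 1) - x k)) 1 := by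
    have hk : (C (k + 1)).fixMany (toVec (x (k + 1) - x k)) 1 =
        (G k).fixMany (toVec (x (k + 1) - x k)) 1 := (hupd k).2.1.trans (hGsec k).symm
    simp only [Tensor.fixMany_one_sub, hk]
    abel
  rw [hsplit]
  refine div_le_of_le_mul₀ (Real.sqrt_nonneg _) (add_nonneg (Real.sqrt_nonneg _)
    (Real.sqrt_nonneg _)) ((Tensor.frobNorm_fixMany_one_le _ _).trans
      (mul_le_mul_of_nonneg_right ?_ (Real.sqrt_nonneg _)))
  simp only [Tensor.frobNorm_eq_norm, WithLp.toLp_sub]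
  exact norm_sub_le _ _
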